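/- Let X and S be measurable spaces, let κ_src, κ_hat, κ_tar be Markov kernels from X to S, let λ ∈ [0,1], and let κ_mix be the mixture kernel defined by κ_mix(x) = λ • κ_src(x) + (1−λ) • κ_hat(x) for every x ∈ X. Let γ ∈ [0,1), let r_max ≥ 0, let ρ be a probability measure on X, and let V : S → ℝ be a measurable function with |V(s)| ≤ r_max/(1−γ) for all s ∈ S. Assume the functions x ↦ D_TV(κ_src(x), κ_tar(x)) and x ↦ D_TV(κ_hat(x), κ_tar(x)) are measurable. If η_mix and η_tar are real numbers satisfying the telescoping identity η_mix − η_tar = (γ/(1−γ)) · ∫_X [ ∫_S V d(κ_mix(x)) − ∫_S V d(κ_tar(x)) ] dρ(x), then η_mix − η_tar ≤ (2 γ r_max/(1−γ)²) · ( λ · ∫_X D_TV(κ_src(x), κ_tar(x)) dρ(x) + (1−λ) · ∫_X D_TV(κ_hat(x), κ_tar(x)) dρ(x) ). -/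

import Mathlib

open MeasureTheory ProbabilityTheory

/-- Total variation distance between two measures:
`D_TV(P, Q) = sup over measurable sets A of |P(A) − Q(A)|`. -/
noncomputable def tvDist {S : Type*} [MeasurableSpace S] (P Q : Measure S) : ℝ :=
  ⨆ A : {A : Set S // MeasurableSet A}, |(P A.1).toReal - (Q A.1).toReal|

theorem abs_sub_le_tvDist {S : Type*} [MeasurableSpace S] (P Q : Measure S)
    [IsProbabilityMeasure P] [IsProbabilityMeasure Q] {A : Set S} (hA : MeasurableSet A) :
    |P.real A - Q.real A| ≤ tvDist P Q := by
  refine le_ciSup (f := fun A : {A : Set S // MeasurableSet A} ↦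
    |(P A.1).toReal - (Q A.1).toReal|) ⟨1, ?_⟩ ⟨A, hA⟩
  rintro _ ⟨B, rfl⟩
  change |P.real B.1 - Q.real B.1| ≤ 1
  have h1 : P.real B.1 ≤ 1 := measureReal_le_one
  have h2 : Q.real B.1 ≤ 1 := measureReal_le_one
  have h3 : 0 ≤ P.real B.1 := measureReal_nonneg
  have h4 : 0 ≤ Q.real B.1 := measureReal_nonneg
  exact abs_le.2 ⟨by linarith, by linarith⟩

theorem tvDist_nonneg {S : Type*} [MeasurableSpace S] (P Q : Measure S) : 0 ≤ tvDist P Q :=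
  Real.iSup_nonneg fun _ ↦ abs_nonneg _

theorem tvDist_le_one {S : Type*} [MeasurableSpace S] (P Q : Measure S)
    [IsProbabilityMeasure P] [IsProbabilityMeasure Q] : tvDist P Q ≤ 1 := by
  refine Real.iSup_le (fun B ↦ ?_) zero_le_one
  change |P.real B.1 - Q.real B.1| ≤ 1
  have h1 : P.real B.1 ≤ 1 := measureReal_le_one
  have h2 : Q.real B.1 ≤ 1 := measureReal_le_one
  have h3 : 0 ≤ P.real B.1 := measureReal_nonneg
  have h4 : 0 ≤ Q.real B.1 := measureReal_nonneg
  exact abs_le.2 ⟨by linarith, by linarith⟩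

theorem integrable_of_measurable_of_abs_le {S : Type*} [MeasurableSpace S] (P : Measure S)
    [IsFiniteMeasure P] {V : S → ℝ} (hV : Measurable V) {M : ℝ} (hVb : ∀ s, |V s| ≤ M) :
    Integrable V P :=
  Integrable.of_bound hV.aestronglyMeasurable M (Filter.Eventually.of_forall hVb)

theorem integral_sub_integral_le_tvDist {S : Type*} [MeasurableSpace S] (P Q : Measure S)
    [IsProbabilityMeasure P] [IsProbabilityMeasure Q] {V : S → ℝ} (hV : Measurable V) {M : ℝ}
    (hM : 0 ≤ M) (hVb : ∀ s, |V s| ≤ M) :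
    ∫ s, V s ∂P - ∫ s, V s ∂Q ≤ 2 * M * tvDist P Q := by
  obtain ⟨A, hA, hpos, hneg⟩ := hahn_decomposition P Q
  have hle : Q.restrict A ≤ P.restrict A := Measure.le_iff.2 fun t ht ↦ by
    rw [Measure.restrict_apply ht, Measure.restrict_apply ht]
    exact hpos _ (ht.inter hA) Set.inter_subset_right
  have hge : P.restrict Aᶜ ≤ Q.restrict Aᶜ := Measure.le_iff.2 fun t ht ↦ by
    rw [Measure.restrict_apply ht, Measure.restrict_apply ht]
    exact hneg _ (ht.inter hA.compl) Set.inter_subset_right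
  have hi (R : Measure S) [IsFiniteMeasure R] : Integrable V R :=
    integrable_of_measurable_of_abs_le R hV hVb
  have h1 : ∫ s in A, (M - V s) ∂Q ≤ ∫ s in A, (M - V s) ∂P :=
    integral_mono_measure hle
      (Filter.Eventually.of_forall fun s ↦ sub_nonneg.2 (abs_le.1 (hVb s)).2)
      ((integrable_const M).sub (hi _))
  have h2 : ∫ s in Aᶜ, (M + V s) ∂P ≤ ∫ s in Aᶜ, (M + V s) ∂Q :=
    integral_mono_measure hge
      (Filter.Eventually.of_forall fun s ↦ by
        change 0 ≤ M + V s
        linarith [(abs_le.1 (hVb s)).1])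
      ((integrable_const M).add (hi _))
  rw [integral_sub (integrable_const M) (hi _), integral_sub (integrable_const M) (hi _)] at h1
  rw [integral_add (integrable_const M) (hi _), integral_add (integrable_const M) (hi _)] at h2
  simp only [setIntegral_const, smul_eq_mul, probReal_compl_eq_one_sub hA] at h1 h2
  have h3 := le_trans (le_abs_self _) (abs_sub_le_tvDist P Q hA)
  rw [← integral_add_compl hA (hi P), ← integral_add_compl hA (hi Q)]
  nlinarith [mul_le_mul_of_nonneg_left h3 hM]

theorem stmt0 {X S : Type*} [MeasurableSpace X] [MeasurableSpace S]
    (κsrc κhat κtar κmix : Kernel X S)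
    [IsMarkovKernel κsrc] [IsMarkovKernel κhat] [IsMarkovKernel κtar] [IsMarkovKernel κmix]
    (l : ℝ) (hl0 : 0 ≤ l) (hl1 : l ≤ 1)
    (hmix : ∀ x, κmix x = ENNReal.ofReal l • κsrc x + ENNReal.ofReal (1 - l) • κhat x)
    (γ : ℝ) (hγ0 : 0 ≤ γ) (hγ1 : γ < 1)
    (rmax : ℝ) (hrmax : 0 ≤ rmax)
    (ρ : Measure X) [IsProbabilityMeasure ρ]
    (V : S → ℝ) (hV : Measurable V) (hVb : ∀ s, |V s| ≤ rmax / (1 - γ))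
    (hmeas1 : Measurable fun x => tvDist (κsrc x) (κtar x))
    (hmeas2 : Measurable fun x => tvDist (κhat x) (κtar x))
    (ηmix ηtar : ℝ)
    (htel : ηmix - ηtar =
      (γ / (1 - γ)) * ∫ x, ((∫ s, V s ∂(κmix x)) - ∫ s, V s ∂(κtar x)) ∂ρ) :
    ηmix - ηtar ≤ (2 * γ * rmax / (1 - γ) ^ 2) *
      (l * ∫ x, tvDist (κsrc x) (κtar x) ∂ρ +
       (1 - l) * ∫ x, tvDist (κhat x) (κtar x) ∂ρ) := by
  have hγ : 0 < 1 - γ := sub_pos.2 hγ1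
  set M := rmax / (1 - γ) with hMdef
  have hM : 0 ≤ M := div_nonneg hrmax hγ.le
  have hi (R : Measure S) [IsFiniteMeasure R] : Integrable V R :=
    integrable_of_measurable_of_abs_le R hV hVb
  have hint (κ : Kernel X S) [IsMarkovKernel κ] : Integrable (fun x ↦ ∫ s, V s ∂(κ x)) ρ := by
    refine integrable_of_measurable_of_abs_le (M := M) ρ
      (hV.stronglyMeasurable.integral_kernel (κ := κ)).measurable fun x ↦ ?_
    simpa using norm_integral_le_of_norm_le_const (μ := κ x) (f := V) (C := M)
      (Filter.Eventually.of_forall hVb)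
  have htv (κ : Kernel X S) [IsMarkovKernel κ]
      (h : Measurable fun x ↦ tvDist (κ x) (κtar x)) :
      Integrable (fun x ↦ tvDist (κ x) (κtar x)) ρ :=
    integrable_of_measurable_of_abs_le ρ h fun x ↦
      (abs_of_nonneg (tvDist_nonneg _ _)).trans_le (tvDist_le_one _ _)
  have hpt (x : X) : ∫ s, V s ∂(κmix x) - ∫ s, V s ∂(κtar x) ≤
      2 * M * (l * tvDist (κsrc x) (κtar x) + (1 - l) * tvDist (κhat x) (κtar x)) := by
    have hl1' : 0 ≤ 1 - l := sub_nonneg.2 hl1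
    rw [hmix, integral_add_measure ((hi _).smul_measure ENNReal.ofReal_ne_top)
      ((hi _).smul_measure ENNReal.ofReal_ne_top), integral_smul_measure, integral_smul_measure,
      ENNReal.toReal_ofReal hl0, ENNReal.toReal_ofReal hl1', smul_eq_mul, smul_eq_mul]
    linarith [mul_le_mul_of_nonneg_left
        (integral_sub_integral_le_tvDist (κsrc x) (κtar x) hV hM hVb) hl0,
      mul_le_mul_of_nonneg_left
        (integral_sub_integral_le_tvDist (κhat x) (κtar x) hV hM hVb) hl1']
  have h1 := (htv κsrc hmeas1).const_mul l
  have h2 := (htv κhat hmeas2).const_mul (1 - l)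
  have hmain := integral_mono ((hint κmix).sub (hint κtar)) ((h1.add h2).const_mul (2 * M)) hpt
  simp only [Pi.sub_apply, Pi.add_apply] at hmain
  rw [integral_const_mul, integral_add h1 h2, integral_const_mul, integral_const_mul] at hmain
  rw [htel]
  refine (mul_le_mul_of_nonneg_left hmain (div_nonneg hγ0 hγ.le)).trans_eq ?_
  rw [hMdef]
  field_simp
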